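/- arXiv:2110.03268 — 2 statements merged into one kernel-verified Lean document; each statement's English description precedes it below -/
import Mathlib

section
/- Let Γ be a finite group, S ⊆ Γ with 1 ∉ S, and S a union of conjugacy classes of Γ (so Cay(Γ,S) is a normal mixed Cayley graph). If Cay(Γ,S) is Gaussian integral, then Cay(Γ,S) is H-integral; that is, if every eigenvalue of the (0,1)-adjacency matrix of Cay(Γ,S) is a Gaussian integer, then every eigenvalue of the Hermitian adjacency matrix of Cay(Γ,S) is an integer. -/
open scoped Classical

noncomputable section

/-- The Hermitian adjacency matrix of the mixed Cayley graph `Cay(Γ, S)`. -/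
def hermitianAdjMatrix {Γ : Type} [Group Γ] [Fintype Γ] [DecidableEq Γ]
    (S : Finset Γ) : Matrix Γ Γ ℂ :=
  Matrix.of fun a b =>
    if b * a⁻¹ ∈ S then (if a * b⁻¹ ∈ S then 1 else Complex.I)
    else (if a * b⁻¹ ∈ S then -Complex.I else 0)

/-- The (0,1)-adjacency matrix of the mixed Cayley graph `Cay(Γ, S)`. -/
def adjMatrix01 {Γ : Type} [Group Γ] [Fintype Γ] [DecidableEq Γ]
    (S : Finset Γ) : Matrix Γ Γ ℂ :=
  Matrix.of fun a b => if b * a⁻¹ ∈ S then 1 else 0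

/-- A matrix is H-integral if all of its eigenvalues are integers. -/
def MatrixIntegral {Γ : Type} [Fintype Γ] [DecidableEq Γ] (M : Matrix Γ Γ ℂ) : Prop :=
  ∀ z ∈ spectrum ℂ M, ∃ k : ℤ, z = (k : ℂ)

/-- A matrix is Gaussian integral if all of its eigenvalues are Gaussian integers. -/
def MatrixGaussianIntegral {Γ : Type} [Fintype Γ] [DecidableEq Γ] (M : Matrix Γ Γ ℂ) : Prop :=
  ∀ z ∈ spectrum ℂ M, ∃ p q : ℤ, z = (p : ℂ) + (q : ℂ) * Complex.I

theorem IsAlgClosed.exists_ringHom_extension {A E M : Type*} [CommRing A] [IsDomain A] [Field E]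
    [Algebra A E] [Module.IsTorsionFree A E] [Algebra.IsAlgebraic A E] [Field M] [IsAlgClosed M]
    (j : A →+* M) (hj : Function.Injective j) :
    ∃ σ : E →+* M, ∀ a, σ (algebraMap A E a) = j a := by
  let := j.toAlgebra
  have : FaithfulSMul A M := (faithfulSMul_iff_algebraMap_injective A M).mpr hj
  exact ⟨(IsAlgClosed.lift : E →ₐ[A] M), fun a => AlgHom.commutes (IsAlgClosed.lift : E →ₐ[A] M) a⟩

theorem RingEquiv.exists_ringHom_extension {F E : Type*} [Field F] [Field E] [Algebra F E]
    [IsAlgClosed E] (τ : F ≃+* F) :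
    ∃ σ : E →+* E, ∀ x, σ (algebraMap F E x) = algebraMap F E (τ x) := by
  obtain ⟨s, hs⟩ := exists_isTranscendenceBasis F E
  let e := hs.1.aevalEquiv
  let j : Algebra.adjoin F (Set.range ((↑) : s → E)) →+* E :=
    ((MvPolynomial.aeval ((↑) : s → E)).toRingHom.comp (MvPolynomial.map (τ : F →+* F))).comp
      (e.symm : _ →+* MvPolynomial s F)
  have hinj : Function.Injective (MvPolynomial.aeval (R := F) ((↑) : s → E)) := hs.1
  have hj : Function.Injective j :=
    (hinj.comp (MvPolynomial.map_injective _ τ.injective)).comp e.symm.injective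
  have := hs.isAlgebraic
  obtain ⟨σ, hσ⟩ := IsAlgClosed.exists_ringHom_extension (E := E) j hj
  refine ⟨σ, fun x => ?_⟩
  have h := hσ (algebraMap F _ x)
  rw [← IsScalarTower.algebraMap_apply] at h
  have h2 : e.symm (algebraMap F _ x) = MvPolynomial.C x := e.symm.commutes x
  rw [h]
  simp only [j, RingHom.comp_apply, RingHom.coe_coe, h2]
  simp

/-- An algebraic integer fixed by all field endomorphisms of `ℂ` is a rational integer. -/
theorem Complex.exists_int_of_isIntegral_of_fixed {z : ℂ} (hz : IsIntegral ℤ z)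
    (hfix : ∀ σ : ℂ →+* ℂ, σ z = z) : ∃ m : ℤ, z = m := by
  let K := algebraicClosure ℚ ℂ
  have hzK : z ∈ K := mem_algebraicClosure_iff.mpr (hz.tower_top (A := ℚ)).isAlgebraic
  have : IsAlgClosure ℚ K := algebraicClosure.isAlgClosure ℚ ℂ
  have : Normal ℚ K := IsAlgClosure.normal ℚ K
  have : IsGalois ℚ K := {}
  have hbot : (⟨z, hzK⟩ : K) ∈ (⊥ : IntermediateField ℚ K) := by
    rw [InfiniteGalois.mem_bot_iff_fixed]
    intro f
    obtain ⟨σ, hσ⟩ := RingEquiv.exists_ringHom_extension (E := ℂ) f.toRingEquiv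
    exact Subtype.ext ((hσ ⟨z, hzK⟩).symm.trans (hfix σ))
  obtain ⟨q, hq⟩ := IntermediateField.mem_bot.mp hbot
  have hq' : algebraMap ℚ ℂ q = z := congrArg Subtype.val hq
  rw [← hq', isIntegral_algebraMap_iff (algebraMap ℚ ℂ).injective] at hz
  obtain ⟨m, hm⟩ := IsIntegrallyClosed.isIntegral_iff.mp hz
  exact ⟨m, by rw [← hq', ← hm]; simp⟩

theorem Complex.exists_coprime_forall_map_eq_pow (σ : ℂ →+* ℂ) (n : ℕ) [NeZero n] :
    ∃ k : ℕ, 0 < k ∧ n.Coprime k ∧ ∀ w : ℂ, w ^ n = 1 → σ w = w ^ k := by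
  have hζ := Complex.isPrimitiveRoot_exp n (NeZero.ne n)
  set ζ := Complex.exp (2 * Real.pi * Complex.I / n)
  obtain ⟨i, -, hi, hσ⟩ := hζ.isPrimitiveRoot_iff.mp (hζ.map_of_injective σ.injective)
  refine ⟨i + n, by have := NeZero.pos n; omega, by simpa using hi.symm, fun w hw => ?_⟩
  obtain ⟨m, -, rfl⟩ := hζ.eq_pow_of_pow_eq_one hw
  rw [map_pow, ← hσ, pow_add _ i n, hw, mul_one, pow_right_comm]

theorem Matrix.isIntegral_of_mem_spectrum {R K n : Type*} [CommRing R] [Field K] [Algebra R K]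
    [Fintype n] [DecidableEq n] {M : Matrix n n K} (hM : ∀ i j, IsIntegral R (M i j)) {z : K}
    (hz : z ∈ spectrum K M) : IsIntegral R z := by
  let N : Matrix n n (integralClosure R K) := .of fun i j => ⟨M i j, hM i j⟩
  have hN : N.map (algebraMap (integralClosure R K) K) = M := rfl
  refine isIntegral_trans (A := integralClosure R K) z ⟨N.charpoly, N.charpoly_monic, ?_⟩
  rw [Matrix.mem_spectrum_iff_isRoot_charpoly, ← hN, Matrix.charpoly_map] at hz
  rwa [← Polynomial.eval_map]

namespace Matrix

variable {n : Type*} [Fintype n] [DecidableEq n]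

theorem exists_trace_eq_natCast_of_isIdempotentElem {K : Type*} [Field K] {E : Matrix n n K}
    (hE : IsIdempotentElem E) : ∃ d : ℕ, E.trace = d := by
  have h : IsIdempotentElem E.toLin' := hE.map (Matrix.toLinAlgEquiv' (R := K))
  exact ⟨_, by rw [← Matrix.trace_toLin'_eq, (LinearMap.IsIdempotentElem.isProj_range _ h).trace]⟩

theorem trace_ne_zero_of_isIdempotentElem {K : Type*} [Field K] [CharZero K] {E : Matrix n n K}
    (hE : IsIdempotentElem E) (h0 : E ≠ 0) : E.trace ≠ 0 := by
  have h : IsIdempotentElem E.toLin' := hE.map (Matrix.toLinAlgEquiv' (R := K))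
  rw [← Matrix.trace_toLin'_eq, Ne, LinearMap.IsIdempotentElem.trace_eq_zero_iff h]
  simpa using h0

open scoped Matrix.Norms.L2Operator

/-- The spectral projection of `M` onto its eigenspace at `z`. -/
def eigenProj (M : Matrix n n ℂ) (z : ℂ) : Matrix n n ℂ :=
  cfc (fun w => if w = z then 1 else 0) M

theorem continuousOn_spectrum (M : Matrix n n ℂ) (f : ℂ → ℂ) : ContinuousOn f (spectrum ℂ M) :=
  M.finite_spectrum.continuousOn f

theorem isIdempotentElem_eigenProj (M : Matrix n n ℂ) (z : ℂ) :
    IsIdempotentElem (M.eigenProj z) := by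
  rw [IsIdempotentElem, eigenProj,
    ← cfc_mul _ _ _ (M.continuousOn_spectrum _) (M.continuousOn_spectrum _)]
  congr 1
  ext w
  simp

theorem star_eigenProj (M : Matrix n n ℂ) (z : ℂ) : star (M.eigenProj z) = M.eigenProj z := by
  rw [eigenProj, ← cfc_star]
  congr 1
  ext w
  split_ifs <;> simp

theorem _root_.Commute.eigenProj {M B : Matrix n n ℂ} (h : Commute M B) (h' : Commute (star M) B)
    (z : ℂ) : Commute (M.eigenProj z) B :=
  h.cfc h' _

theorem cfc_mul_eigenProj (M : Matrix n n ℂ) (f : ℂ → ℂ) (z : ℂ) :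
    cfc f M * M.eigenProj z = f z • M.eigenProj z := by
  rw [eigenProj, ← cfc_mul _ _ _ (M.continuousOn_spectrum _) (M.continuousOn_spectrum _),
    ← cfc_const_mul _ _ _ (M.continuousOn_spectrum _)]
  congr 1
  ext w
  by_cases h : w = z <;> simp [h]

theorem mul_eigenProj {M : Matrix n n ℂ} (hM : IsStarNormal M) (z : ℂ) :
    M * M.eigenProj z = z • M.eigenProj z := by
  have h := M.cfc_mul_eigenProj (fun w => w) z
  rwa [cfc_id' ℂ M] at h

theorem cfc_eq_sum_eigenProj (M : Matrix n n ℂ) (f : ℂ → ℂ) :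
    cfc f M = ∑ z ∈ M.finite_spectrum.toFinset, f z • M.eigenProj z := by
  simp_rw [eigenProj, ← cfc_const_mul _ _ M (M.continuousOn_spectrum _)]
  rw [← cfc_sum _ _ _ fun _ _ => M.continuousOn_spectrum _]
  refine cfc_congr fun w hw => ?_
  simp [hw]

theorem nontrivial_of_mem_spectrum {M : Matrix n n ℂ} {z : ℂ} (hz : z ∈ spectrum ℂ M) :
    Nontrivial (Matrix n n ℂ) := by
  by_contra hn
  rw [not_nontrivial_iff_subsingleton] at hn
  rw [spectrum.of_subsingleton] at hz
  exact hz

theorem eigenProj_ne_zero {M : Matrix n n ℂ} (hM : IsStarNormal M) {z : ℂ}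
    (hz : z ∈ spectrum ℂ M) : M.eigenProj z ≠ 0 := by
  intro h
  have hmap := cfc_map_spectrum (fun w => if w = z then 1 else 0) M hM
    (M.continuousOn_spectrum _)
  have := nontrivial_of_mem_spectrum hz
  have h1 : (1 : ℂ) ∈ spectrum ℂ (M.eigenProj z) := by
    rw [eigenProj, hmap]
    exact ⟨z, hz, by simp⟩
  rw [h, spectrum.zero_eq] at h1
  exact one_ne_zero h1

theorem map_trace_eq_trace_pow {M : Matrix n n ℂ} (hM : IsStarNormal M) {N k : ℕ} (hk : 0 < k)
    (hMN : M ^ (N + 1) = M) {σ : ℂ →+* ℂ} (hσ : ∀ w : ℂ, w ^ N = 1 → σ w = w ^ k) :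
    σ M.trace = (M ^ k).trace := by
  have hspec : ∀ w ∈ spectrum ℂ M, σ w = w ^ k := by
    intro w hw
    have h := spectrum.subset_polynomial_aeval M (Polynomial.X ^ (N + 1) - Polynomial.X)
      ⟨w, hw, rfl⟩
    have := nontrivial_of_mem_spectrum hw
    simp only [map_sub, map_pow, Polynomial.aeval_X, hMN, sub_self, spectrum.zero_eq] at h
    have h0 : w * (w ^ N - 1) = 0 := by simpa [mul_sub, pow_succ'] using h
    rcases mul_eq_zero.mp h0 with rfl | h0
    · simp [hk.ne']
    · exact hσ w (sub_eq_zero.mp h0)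
  have h1 : M.trace = ∑ z ∈ M.finite_spectrum.toFinset, z * (M.eigenProj z).trace := by
    conv_lhs => rw [← cfc_id' ℂ M, cfc_eq_sum_eigenProj]
    simp [trace_sum]
  rw [h1, ← cfc_pow_id (R := ℂ) M k, cfc_eq_sum_eigenProj, trace_sum, map_sum]
  refine Finset.sum_congr rfl fun z hz => ?_
  obtain ⟨d, hd⟩ := exists_trace_eq_natCast_of_isIdempotentElem (M.isIdempotentElem_eigenProj z)
  rw [trace_smul, hd, map_mul, map_natCast, hspec z (by simpa using hz), smul_eq_mul]

end Matrix

section CayleyMatrix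

variable {Γ : Type} [Group Γ]

/-- The adjacency matrix of the Cayley digraph on `Γ` whose arcs are weighted by `f`. -/
def cayleyMatrix (f : Γ → ℂ) : Matrix Γ Γ ℂ := Matrix.of fun a b => f (b * a⁻¹)

theorem star_cayleyMatrix (f : Γ → ℂ) :
    star (cayleyMatrix f) = cayleyMatrix fun x => star (f x⁻¹) := by
  ext a b
  simp [cayleyMatrix, Matrix.star_apply]

variable [DecidableEq Γ]

/-- The permutation matrix of left translation by `g`. -/
def translationMatrix (g : Γ) : Matrix Γ Γ ℂ := cayleyMatrix fun x => if x = g then 1 else 0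

theorem translationMatrix_one : translationMatrix (1 : Γ) = 1 := by
  ext a b
  simp [translationMatrix, cayleyMatrix, Matrix.one_apply, mul_inv_eq_one, eq_comm]

theorem star_translationMatrix (g : Γ) :
    star (translationMatrix g) = translationMatrix g⁻¹ := by
  rw [translationMatrix, star_cayleyMatrix, translationMatrix]
  congr 1
  ext x
  simp only [inv_eq_iff_eq_inv]
  split_ifs <;> simp

variable [Fintype Γ]

theorem mul_translationMatrix_apply (M : Matrix Γ Γ ℂ) (g a b : Γ) :
    (M * translationMatrix g) a b = M a (g⁻¹ * b) := by
  rw [Matrix.mul_apply, Finset.sum_eq_single (g⁻¹ * b)]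
  · simp [translationMatrix, cayleyMatrix]
  · intro c _ hc
    have : b * c⁻¹ ≠ g := by
      rintro rfl
      simp at hc
    simp [translationMatrix, cayleyMatrix, this]
  · simp

theorem translationMatrix_mul_apply (M : Matrix Γ Γ ℂ) (g a b : Γ) :
    (translationMatrix g * M) a b = M (g * a) b := by
  rw [Matrix.mul_apply, Finset.sum_eq_single (g * a)]
  · simp [translationMatrix, cayleyMatrix]
  · intro c _ hc
    have : c * a⁻¹ ≠ g := by
      rintro rfl
      simp at hc
    simp [translationMatrix, cayleyMatrix, this]
  · simp

theorem translationMatrix_mul (g h : Γ) :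
    translationMatrix g * translationMatrix h = translationMatrix (h * g) := by
  ext a b
  rw [translationMatrix_mul_apply]
  simp [translationMatrix, cayleyMatrix, mul_inv_eq_iff_eq_mul, mul_assoc]

theorem translationMatrix_pow (g : Γ) (k : ℕ) :
    translationMatrix g ^ k = translationMatrix (g ^ k) := by
  induction k with
  | zero => simp [translationMatrix_one]
  | succ k ih => rw [pow_succ, ih, translationMatrix_mul, pow_succ']

theorem cayleyMatrix_eq_sum (f : Γ → ℂ) :
    cayleyMatrix f = ∑ g, f g • translationMatrix g := by
  ext a b
  simp [translationMatrix, cayleyMatrix, Matrix.sum_apply]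

theorem trace_translationMatrix_mul_cayleyMatrix (g : Γ) (f : Γ → ℂ) :
    (translationMatrix g * cayleyMatrix f).trace = Fintype.card Γ * f g⁻¹ := by
  simp [Matrix.trace, translationMatrix_mul_apply, cayleyMatrix]

theorem commute_cayleyMatrix_translationMatrix {f : Γ → ℂ} (hf : ∀ x y, f (x * y * x⁻¹) = f y)
    (g : Γ) : Commute (cayleyMatrix f) (translationMatrix g) := by
  ext a b
  rw [mul_translationMatrix_apply, translationMatrix_mul_apply]
  simp only [cayleyMatrix, Matrix.of_apply]
  rw [← hf g (g⁻¹ * b * a⁻¹)]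
  congr 1
  group

theorem Commute.star_translationMatrix {M : Matrix Γ Γ ℂ}
    (h : ∀ g, Commute M (translationMatrix g)) (g : Γ) :
    Commute (star M) (translationMatrix g) := by
  rw [← inv_inv g, ← _root_.star_translationMatrix]
  exact (h g⁻¹).star_star

theorem isStarNormal_cayleyMatrix {f : Γ → ℂ} (hf : ∀ x y, f (x * y * x⁻¹) = f y) :
    IsStarNormal (cayleyMatrix f) := by
  refine ⟨?_⟩
  nth_rewrite 2 [cayleyMatrix_eq_sum]
  exact Commute.sum_right _ _ _ fun g _ => (Commute.star_translationMatrix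
    (commute_cayleyMatrix_translationMatrix hf) g).smul_right _

theorem map_trace_translationMatrix_mul_eigenProj {M : Matrix Γ Γ ℂ}
    (hM : ∀ g, Commute M (translationMatrix g)) {σ : ℂ →+* ℂ} {k : ℕ} (hk : 0 < k)
    (hσ : ∀ w : ℂ, w ^ Fintype.card Γ = 1 → σ w = w ^ k) (g : Γ) (z : ℂ) :
    σ (translationMatrix g * M.eigenProj z).trace =
      (translationMatrix (g ^ k) * M.eigenProj z).trace := by
  have hE : ∀ h, Commute (M.eigenProj z) (translationMatrix h) := fun h =>
    (hM h).eigenProj (Commute.star_translationMatrix hM h) z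
  have hpow : ∀ m, 0 < m → (translationMatrix g * M.eigenProj z) ^ m =
      translationMatrix (g ^ m) * M.eigenProj z := by
    intro m hm
    obtain ⟨m, rfl⟩ := Nat.exists_eq_add_one.mpr hm
    rw [(hE g).symm.mul_pow, translationMatrix_pow,
      (M.isIdempotentElem_eigenProj z).pow_succ_eq]
  rw [← hpow k hk]
  refine Matrix.map_trace_eq_trace_pow ⟨?_⟩ (N := Fintype.card Γ) hk ?_ hσ
  · rw [star_mul, star_translationMatrix, Matrix.star_eigenProj]
    have h : Commute (translationMatrix g⁻¹) (translationMatrix g) := by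
      rw [commute_iff_eq, translationMatrix_mul, translationMatrix_mul]
      simp
    exact .mul_left ((hE g).mul_right (.refl _)) (h.mul_right (hE g⁻¹).symm)
  · rw [hpow _ (Nat.succ_pos _), pow_succ, pow_card_eq_one, one_mul]

theorem map_trace_cayleyMatrix_mul_eigenProj {M : Matrix Γ Γ ℂ}
    (hM : ∀ g, Commute M (translationMatrix g)) {σ : ℂ →+* ℂ} {k : ℕ} (hk : 0 < k)
    (hσ : ∀ w : ℂ, w ^ Fintype.card Γ = 1 → σ w = w ^ k) (f : Γ → ℂ) (z : ℂ) :
    σ (cayleyMatrix f * M.eigenProj z).trace =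
      ((∑ g, σ (f g) • translationMatrix (g ^ k)) * M.eigenProj z).trace := by
  simp_rw [cayleyMatrix_eq_sum, Finset.sum_mul, Matrix.trace_sum, map_sum, smul_mul_assoc,
    Matrix.trace_smul, smul_eq_mul, map_mul,
    map_trace_translationMatrix_mul_eigenProj hM hk hσ]

open scoped Matrix.Norms.L2Operator in
/-- If `σ` acts on the eigenvalues of the normal Cayley digraph of `S` as `φ`, and `φ` of its
adjacency matrix is the adjacency matrix for `T`, then `g ↦ g ^ k` maps `S` into `T`. -/
theorem pow_mem_of_map_eigenvalue {S T : Finset Γ} (hS : ∀ x y, x * y * x⁻¹ ∈ S ↔ y ∈ S)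
    (hcard : T.card = S.card) {σ : ℂ →+* ℂ} {k : ℕ} (hk : 0 < k)
    (hσ : ∀ w : ℂ, w ^ Fintype.card Γ = 1 → σ w = w ^ k) (φ : ℂ → ℂ)
    (hφ : ∀ z ∈ spectrum ℂ (cayleyMatrix fun g => if g ∈ S then (1 : ℂ) else 0), σ z = φ z)
    (hT : cfc φ (cayleyMatrix fun g => if g ∈ S then (1 : ℂ) else 0) =
      cayleyMatrix fun g => if g ∈ T then 1 else 0) {s : Γ} (hs : s ∈ S) : s ^ k ∈ T := by
  have hf : ∀ x y, (if x * y * x⁻¹ ∈ S then (1 : ℂ) else 0) = if y ∈ S then 1 else 0 := by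
    simp [hS]
  have hcomm := commute_cayleyMatrix_translationMatrix (f := fun g => if g ∈ S then 1 else 0) hf
  have hnormal := isStarNormal_cayleyMatrix (f := fun g => if g ∈ S then 1 else 0) hf
  set A := cayleyMatrix fun g => if g ∈ S then (1 : ℂ) else 0 with hA
  set B := cayleyMatrix fun g => if g ∈ T then (1 : ℂ) else 0 with hB
  set C := ∑ g ∈ S, translationMatrix (g ^ k) with hC
  have hE : ∀ z ∈ spectrum ℂ A, (C * A.eigenProj z).trace = (B * A.eigenProj z).trace := by
    intro z hz
    have h := map_trace_cayleyMatrix_mul_eigenProj hcomm hk hσ (fun g => if g ∈ S then 1 else 0) z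
    obtain ⟨d, hd⟩ := Matrix.exists_trace_eq_natCast_of_isIdempotentElem
      (A.isIdempotentElem_eigenProj z)
    rw [← hA, Matrix.mul_eigenProj hnormal, Matrix.trace_smul, hd, smul_eq_mul, map_mul, map_natCast, hφ z hz] at h
    rw [← hT, A.cfc_mul_eigenProj, Matrix.trace_smul, hd, smul_eq_mul, h]
    simp [hC, apply_ite σ, ite_smul]
  have htr : (C * star B).trace = (B * star B).trace := by
    rw [← hT, ← cfc_star, A.cfc_eq_sum_eigenProj (fun x => star (φ x)), hT]
    simp_rw [Finset.mul_sum, Matrix.trace_sum, mul_smul_comm, Matrix.trace_smul]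
    exact Finset.sum_congr rfl fun z hz => by rw [hE z (by simpa using hz)]
  rw [hC, hB, star_cayleyMatrix] at htr
  nth_rewrite 2 [cayleyMatrix_eq_sum] at htr
  simp_rw [Finset.sum_mul, Matrix.trace_sum, smul_mul_assoc, Matrix.trace_smul,
    trace_translationMatrix_mul_cayleyMatrix] at htr
  have hcount : (S.filter fun g => g ^ k ∈ T).card = S.card := by
    have hne : (Fintype.card Γ : ℂ) ≠ 0 := by simp
    rw [← hcard, ← Nat.cast_inj (R := ℂ), ← mul_right_inj' hne]
    simpa [apply_ite star, mul_comm, Finset.sum_ite] using htr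
  exact Finset.filter_eq_self.mp (Finset.eq_of_subset_of_card_le (Finset.filter_subset _ _)
    hcount.ge) s hs

end CayleyMatrix

/-- A bijection of a finite type that maps a finite set into itself also reflects membership. -/
theorem Finset.mem_iff_apply_mem_of_mapsTo {α : Type*} {S : Finset α} {e : α → α}
    (he : Function.Injective e) (h : ∀ s ∈ S, e s ∈ S) (a : α) : a ∈ S ↔ e a ∈ S := by
  refine ⟨h a, fun ha => ?_⟩
  have hmap : S.map ⟨e, he⟩ = S := Finset.eq_of_subset_of_card_le
    (fun x hx => by obtain ⟨s, hs, rfl⟩ := Finset.mem_map.mp hx; exact h s hs) (by simp)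
  rw [← hmap] at ha
  simpa using ha

theorem Complex.map_I_eq_or (σ : ℂ →+* ℂ) : σ Complex.I = Complex.I ∨ σ Complex.I = -Complex.I :=
  sq_eq_sq_iff_eq_or_eq_neg.mp (by rw [← map_pow]; simp)

/-- The weight function of the Hermitian adjacency matrix. -/
def hermitianWeight {Γ : Type} [Group Γ] [DecidableEq Γ] (S : Finset Γ) (x : Γ) : ℂ :=
  if x ∈ S then (if x⁻¹ ∈ S then 1 else Complex.I)
  else (if x⁻¹ ∈ S then -Complex.I else 0)

section Hermitian

variable {Γ : Type} [Group Γ] [DecidableEq Γ]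

theorem hermitianAdjMatrix_eq_cayleyMatrix [Fintype Γ] (S : Finset Γ) :
    hermitianAdjMatrix S = cayleyMatrix (hermitianWeight S) := by
  ext a b
  simp [hermitianAdjMatrix, cayleyMatrix, hermitianWeight]

theorem isIntegral_hermitianWeight (S : Finset Γ) (x : Γ) :
    IsIntegral ℤ (hermitianWeight S x) := by
  have hI : IsIntegral ℤ Complex.I := Complex.isIntegral_int_I
  unfold hermitianWeight
  split_ifs
  exacts [isIntegral_one, hI, hI.neg, isIntegral_zero]

theorem hermitianWeight_conj {S : Finset Γ} (hS : ∀ x y, x * y * x⁻¹ ∈ S ↔ y ∈ S) (x y : Γ) :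
    hermitianWeight S (x * y * x⁻¹) = hermitianWeight S y := by
  have h : (x * y * x⁻¹)⁻¹ = x * y⁻¹ * x⁻¹ := by group
  simp [hermitianWeight, h, hS]

variable [Fintype Γ]

open scoped Matrix.Norms.L2Operator in
theorem map_hermitianWeight_eq {S : Finset Γ} (hS : ∀ x y, x * y * x⁻¹ ∈ S ↔ y ∈ S)
    (hG : MatrixGaussianIntegral (adjMatrix01 S)) {σ : ℂ →+* ℂ} {k : ℕ} (hk : 0 < k)
    (hcop : (Nat.card Γ).Coprime k)
    (hσ : ∀ w : ℂ, w ^ Fintype.card Γ = 1 → σ w = w ^ k) (g : Γ) :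
    σ (hermitianWeight S g) = hermitianWeight S (g ^ k) := by
  have hnormal := isStarNormal_cayleyMatrix (f := fun g => if g ∈ S then 1 else 0)
    (by simp [hS])
  have hinj : Function.Injective fun g : Γ => g ^ k := (powCoprime hcop).injective
  rcases Complex.map_I_eq_or σ with hI | hI
  · have h := Finset.mem_iff_apply_mem_of_mapsTo hinj fun s hs =>
      pow_mem_of_map_eigenvalue hS rfl hk hσ (fun z => z)
        (fun z hz => by obtain ⟨p, q, rfl⟩ := hG z hz; simp [hI]) (cfc_id' ℂ _) hs
    simp only [hermitianWeight, ← inv_pow, ← h]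
    split_ifs <;> simp [hI]
  · have h := Finset.mem_iff_apply_mem_of_mapsTo (S := S) (inv_injective.comp hinj) fun s hs => by
      have hmem := pow_mem_of_map_eigenvalue (T := S.map (Equiv.inv Γ).toEmbedding) hS (by simp)
        hk hσ star (fun z hz => by obtain ⟨p, q, rfl⟩ := hG z hz; simp [hI])
        (by
          rw [cfc_star_id (R := ℂ) _ hnormal, star_cayleyMatrix]
          congr 1
          ext x
          simp [apply_ite]) hs
      simpa [inv_eq_iff_eq_inv] using hmem
    have h' : ∀ x : Γ, x ^ k ∈ S ↔ x⁻¹ ∈ S := fun x => by simpa using (h x⁻¹).symm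
    simp only [hermitianWeight, ← inv_pow, h', inv_inv]
    split_ifs <;> simp [hI]

theorem map_eq_of_mem_spectrum_hermitianAdjMatrix {S : Finset Γ}
    (hS : ∀ x y, x * y * x⁻¹ ∈ S ↔ y ∈ S) (hG : MatrixGaussianIntegral (adjMatrix01 S))
    {z : ℂ} (hz : z ∈ spectrum ℂ (hermitianAdjMatrix S)) (σ : ℂ →+* ℂ) : σ z = z := by
  obtain ⟨k, hk, hcop, hσ⟩ := Complex.exists_coprime_forall_map_eq_pow σ (Fintype.card Γ)
  rw [← Nat.card_eq_fintype_card] at hcop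
  have hcomm := commute_cayleyMatrix_translationMatrix (hermitianWeight_conj hS)
  have hnormal := isStarNormal_cayleyMatrix (hermitianWeight_conj hS)
  rw [hermitianAdjMatrix_eq_cayleyMatrix] at hz
  have h := map_trace_cayleyMatrix_mul_eigenProj hcomm hk hσ (hermitianWeight S) z
  have hsum : ∑ g, σ (hermitianWeight S g) • translationMatrix (g ^ k) =
      cayleyMatrix (hermitianWeight S) := by
    rw [cayleyMatrix_eq_sum]
    exact Fintype.sum_equiv (powCoprime hcop) _ _ fun g => by
      simp [map_hermitianWeight_eq hS hG hk hcop hσ]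
  rw [hsum, Matrix.mul_eigenProj hnormal, Matrix.trace_smul, smul_eq_mul, map_mul] at h
  have hidem := Matrix.isIdempotentElem_eigenProj (cayleyMatrix (hermitianWeight S)) z
  have h0 := Matrix.trace_ne_zero_of_isIdempotentElem hidem (Matrix.eigenProj_ne_zero hnormal hz)
  obtain ⟨d, hd⟩ := Matrix.exists_trace_eq_natCast_of_isIdempotentElem hidem
  rw [hd] at h h0
  rw [map_natCast] at h
  exact mul_right_cancel₀ h0 h

end Hermitian

/-- If a normal mixed Cayley graph `Cay(Γ, S)` is Gaussian integral, then it is H-integral. -/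
theorem normal_mixed_cayley_gaussian_integral_imp_HIntegral
    (Γ : Type) [Group Γ] [Fintype Γ] [DecidableEq Γ]
    (S : Finset Γ) (hS1 : (1 : Γ) ∉ S)
    (hnormal : ∀ s ∈ S, ∀ x : Γ, x * s * x⁻¹ ∈ S)
    (hG : MatrixGaussianIntegral (adjMatrix01 S)) :
    MatrixIntegral (hermitianAdjMatrix S) := by
  have hS : ∀ x y, x * y * x⁻¹ ∈ S ↔ y ∈ S := fun x y =>
    ⟨fun h => by simpa [mul_assoc] using hnormal _ h x⁻¹, fun h => hnormal y h x⟩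
  intro z hz
  refine Complex.exists_int_of_isIntegral_of_fixed
    (Matrix.isIntegral_of_mem_spectrum (fun a b => ?_) hz)
    (map_eq_of_mem_spectrum_hermitianAdjMatrix hS hG hz)
  rw [hermitianAdjMatrix_eq_cayleyMatrix]
  exact isIntegral_hermitianWeight S _
end
end

section
/- Let Γ be a finite group, S ⊆ Γ with 1 ∉ S, and S a union of conjugacy classes of Γ (so Cay(Γ,S) is a normal mixed Cayley graph). Then Cay(Γ,S) is H-integral if and only if Cay(Γ,S) is Gaussian integral; that is, every eigenvalue of the Hermitian adjacency matrix of Cay(Γ,S) is an integer if and only if every eigenvalue of the (0,1)-adjacency matrix of Cay(Γ,S) is a Gaussian integer. -/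
open scoped Classical

noncomputable section

open Module Module.End in
/-- The traces of the powers of an endomorphism of finite order are the power sums of a family of
roots of unity. -/
theorem exists_trace_pow_eq_sum_of_pow_eq_one {V : Type*} [AddCommGroup V] [Module ℂ V]
    [FiniteDimensional ℂ V] (T : Module.End ℂ V) {n : ℕ} (hn : n ≠ 0) (hT : T ^ n = 1) :
    ∃ (s : Finset ℂ) (d : ℂ → ℕ), (∀ z ∈ s, z ^ n = 1) ∧
      ∀ k : ℕ, LinearMap.trace ℂ V (T ^ k) = ∑ z ∈ s, (d z : ℂ) * z ^ k := by
  have hss : T.IsSemisimple := by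
    refine isSemisimple_of_squarefree_aeval_eq_zero (p := Polynomial.X ^ n - 1) ?_ (by simp [hT])
    exact ((Polynomial.X_pow_sub_one_separable_iff).2 (Nat.cast_ne_zero.2 hn)).squarefree
  have hint := DirectSum.isInternal_submodule_of_iSupIndep_of_iSup_eq_top
    T.eigenspaces_iSupIndep hss.iSup_eigenspace_eq_top
  have hfin : {z | T.eigenspace z ≠ ⊥}.Finite :=
    WellFoundedGT.finite_ne_bot_of_iSupIndep T.eigenspaces_iSupIndep
  have hpow : ∀ (k : ℕ) (z : ℂ), ∀ v ∈ T.eigenspace z, (T ^ k) v = z ^ k • v := by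
    intro k z v hv
    rw [mem_eigenspace_iff] at hv
    induction k with
    | zero => simp
    | succ k ih => rw [pow_succ, Module.End.mul_apply, hv, map_smul, ih, smul_smul, pow_succ']
  refine ⟨hfin.toFinset, fun z ↦ finrank ℂ (T.eigenspace z), fun z hz ↦ ?_, fun k ↦ ?_⟩
  · obtain ⟨v, hv, hv0⟩ := (Submodule.ne_bot_iff _).1 (hfin.mem_toFinset.1 hz)
    have h := hpow n z v hv
    rw [hT, Module.End.one_apply] at h
    exact smul_left_injective ℂ hv0 (by simpa using h.symm)
  · have hmaps : ∀ z, Set.MapsTo (T ^ k) (T.eigenspace z) (T.eigenspace z) := fun z v hv ↦ by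
      rw [SetLike.mem_coe, hpow k z v hv]
      exact Submodule.smul_mem _ _ hv
    rw [LinearMap.trace_eq_sum_trace_restrict' hint hfin hmaps]
    refine Finset.sum_congr rfl fun z _ ↦ ?_
    have : (T ^ k).restrict (hmaps z) = z ^ k • LinearMap.id := by
      ext v
      exact hpow k z v v.2
    rw [this, map_smul, LinearMap.trace_id, smul_eq_mul, mul_comm]

section GaloisTwist

variable {Γ : Type} [Group Γ] [Fintype Γ]

/-- The endomorphism through which the element `∑ s, φ s • s` of the group algebra acts. -/
def weightedSum {V : Type*} [AddCommGroup V] [Module ℂ V] (ρ : Representation ℂ Γ V)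
    (φ : Γ → ℂ) : Module.End ℂ V :=
  ∑ s, φ s • ρ s

/-- A class function acts by endomorphisms commuting with the group. -/
theorem commute_weightedSum {V : Type*} [AddCommGroup V] [Module ℂ V] (ρ : Representation ℂ Γ V)
    {φ : Γ → ℂ} (hφ : ∀ s x, φ (x * s * x⁻¹) = φ s) (g : Γ) :
    Commute (weightedSum ρ φ) (ρ g) := by
  have h : weightedSum ρ φ * ρ g = ρ g * weightedSum ρ φ := by
    simp only [weightedSum, Finset.sum_mul, Finset.mul_sum, smul_mul_assoc, mul_smul_comm,
      ← map_mul]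
    refine Fintype.sum_equiv (MulAut.conj g⁻¹).toEquiv _ _ fun s ↦ ?_
    have := hφ s g⁻¹
    simp_all [mul_assoc]
  exact h

theorem commute_weightedSum_weightedSum {V : Type*} [AddCommGroup V] [Module ℂ V]
    (ρ : Representation ℂ Γ V) {φ : Γ → ℂ} (hφ : ∀ s x, φ (x * s * x⁻¹) = φ s) (ψ : Γ → ℂ) :
    Commute (weightedSum ρ φ) (weightedSum ρ ψ) :=
  Commute.sum_right _ _ _ fun s _ ↦ (commute_weightedSum ρ hφ s).smul_right _

theorem weightedSum_toRepresentation_apply {V : Type*} [AddCommGroup V] [Module ℂ V]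
    {ρ : Representation ℂ Γ V} (W : Subrepresentation ρ) (φ : Γ → ℂ) (v : W.toSubmodule) :
    (weightedSum W.toRepresentation φ v : V) = weightedSum ρ φ v := by
  simp [weightedSum, LinearMap.sum_apply, Subrepresentation.toRepresentation]

variable {K : Type*} [Field K] [Algebra K ℂ]

/-- A `K`-automorphism of the field generated by the `n`-th roots of unity that raises these roots
to the power `k` sends the trace of a group element to the trace of its `k`-th power. -/
theorem exists_trace_galois {F : IntermediateField K ℂ}
    (hF : ∀ z : ℂ, z ^ Fintype.card Γ = 1 → z ∈ F) {σ : F ≃ₐ[K] F} {k : ℕ}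
    (hσ : ∀ z : F, z ^ Fintype.card Γ = 1 → σ z = z ^ k)
    {V : Type*} [AddCommGroup V] [Module ℂ V] [FiniteDimensional ℂ V]
    (ρ : Representation ℂ Γ V) (g : Γ) :
    ∃ c : F, (c : ℂ) = LinearMap.trace ℂ V (ρ g) ∧
      (σ c : ℂ) = LinearMap.trace ℂ V (ρ (g ^ k)) := by
  obtain ⟨s, d, hs, htr⟩ := exists_trace_pow_eq_sum_of_pow_eq_one (ρ g) Fintype.card_ne_zero
    (by rw [← map_pow, pow_card_eq_one, map_one])
  refine ⟨∑ z ∈ s.attach, (d z : F) * ⟨z, hF z (hs z z.2)⟩, ?_, ?_⟩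
  · rw [← pow_one (ρ g), htr 1, ← Finset.sum_attach s]
    simp
  · rw [map_pow, htr k, ← Finset.sum_attach s, map_sum]
    simp only [map_mul, map_natCast]
    push_cast
    refine Finset.sum_congr rfl fun z _ ↦ ?_
    rw [hσ _ (Subtype.ext (by simpa using hs z z.2))]
    simp

/-- If `∑ s, f s • s` acts as the scalar `l` and `∑ s, f s • s ^ k` as the scalar `m`, then `m` is
the Galois conjugate of `l`. -/
theorem exists_scalar_galois {F : IntermediateField K ℂ}
    (hF : ∀ z : ℂ, z ^ Fintype.card Γ = 1 → z ∈ F) {σ : F ≃ₐ[K] F} {k : ℕ}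
    (hσ : ∀ z : F, z ^ Fintype.card Γ = 1 → σ z = z ^ k)
    {V : Type*} [AddCommGroup V] [Module ℂ V] [FiniteDimensional ℂ V] [Nontrivial V]
    (ρ : Representation ℂ Γ V) (f : Γ → K) {l m : ℂ}
    (hl : ∑ s, algebraMap K ℂ (f s) • ρ s = l • 1)
    (hm : ∑ s, algebraMap K ℂ (f s) • ρ (s ^ k) = m • 1) :
    ∃ c : F, (c : ℂ) = l ∧ (σ c : ℂ) = m := by
  choose c hc hσc using exists_trace_galois hF hσ ρ
  have hd : (Module.finrank ℂ V : ℂ) ≠ 0 := Nat.cast_ne_zero.2 Module.finrank_pos.ne'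
  apply_fun LinearMap.trace ℂ V at hl hm
  simp only [map_sum, map_smul, LinearMap.trace_one, smul_eq_mul] at hl hm
  simp only [← hc] at hl
  simp only [← hσc] at hm
  refine ⟨(∑ s, algebraMap K F (f s) * c s) / (Module.finrank ℂ V : F), ?_, ?_⟩
  · push_cast
    rw [div_eq_iff hd, ← hl]
  · simp only [map_div₀, map_sum, map_mul, map_natCast, AlgEquiv.commutes]
    push_cast
    rw [div_eq_iff hd, ← hm]

/-- The matrix with entries `φ (b * a⁻¹)`. -/
def quotientMatrix (φ : Γ → ℂ) : Matrix Γ Γ ℂ :=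
  Matrix.of fun a b ↦ φ (b * a⁻¹)

theorem class_mul_comm {G : Type*} [Group G] {φ : G → ℂ} (hφ : ∀ s x, φ (x * s * x⁻¹) = φ s)
    (a b : G) :
    φ (a * b) = φ (b * a) := by
  simpa [mul_assoc] using hφ (b * a) a

/-- The right regular representation on functions. -/
def rightRegular (Γ : Type) [Group Γ] : Representation ℂ Γ (Γ → ℂ) where
  toFun s := LinearMap.funLeft ℂ ℂ fun a ↦ a * s
  map_one' := by ext; simp [LinearMap.funLeft]
  map_mul' s t := by ext; simp [LinearMap.funLeft, mul_assoc]

theorem toLin'_quotientMatrix [DecidableEq Γ] {φ : Γ → ℂ} (hφ : ∀ s x, φ (x * s * x⁻¹) = φ s) :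
    Matrix.toLin' (quotientMatrix φ) = weightedSum (rightRegular Γ) φ := by
  refine LinearMap.ext fun v ↦ funext fun a ↦ ?_
  simp only [Matrix.toLin'_apply, Matrix.mulVec, dotProduct, quotientMatrix, Matrix.of_apply,
    weightedSum, LinearMap.sum_apply, Finset.sum_apply, LinearMap.smul_apply, Pi.smul_apply,
    smul_eq_mul]
  refine Fintype.sum_equiv (Equiv.mulLeft a⁻¹) _ _ fun b ↦ ?_
  simp [rightRegular, LinearMap.funLeft, class_mul_comm hφ b]

open scoped Matrix.Norms.L2Operator in
/-- The matrix of a class function is normal, so it vanishes as soon as its spectrum does. -/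
theorem eq_zero_of_spectrum_quotientMatrix [DecidableEq Γ] {φ : Γ → ℂ}
    (hφ : ∀ s x, φ (x * s * x⁻¹) = φ s)
    (h : ∀ z ∈ spectrum ℂ (quotientMatrix φ), z = 0) (s : Γ) : φ s = 0 := by
  have hstar : star (quotientMatrix φ) = quotientMatrix fun s ↦ star (φ s⁻¹) := by
    ext a b
    simp [quotientMatrix, Matrix.star_apply]
  have hφ' : ∀ s x, star (φ (x * s * x⁻¹)⁻¹) = star (φ s⁻¹) := fun s x ↦ by
    rw [← hφ s⁻¹ x, mul_inv_rev, mul_inv_rev, inv_inv, mul_assoc]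
  have hnormal : IsStarNormal (quotientMatrix φ) := by
    constructor
    rw [hstar]
    refine Matrix.toLin'.injective ?_
    rw [Matrix.toLin'_mul, Matrix.toLin'_mul, toLin'_quotientMatrix hφ, toLin'_quotientMatrix hφ']
    exact commute_weightedSum_weightedSum _ hφ' _
  have hzero : quotientMatrix φ = 0 := by
    have hr := IsStarNormal.spectralRadius_eq_nnnorm (quotientMatrix φ)
    rw [spectralRadius, ENNReal.iSup_eq_zero.2 fun z ↦ ENNReal.iSup_eq_zero.2 fun hz ↦ by
      simp [h z hz]] at hr
    simpa using hr.symm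
  simpa [quotientMatrix] using congrFun (congrFun hzero 1) s

/-- The common eigenspace of two class functions, as a subrepresentation. -/
def eigenSubrepresentation {V : Type*} [AddCommGroup V] [Module ℂ V] (ρ : Representation ℂ Γ V)
    {φ ψ : Γ → ℂ} (hφ : ∀ s x, φ (x * s * x⁻¹) = φ s) (hψ : ∀ s x, ψ (x * s * x⁻¹) = ψ s)
    (l m : ℂ) : Subrepresentation ρ where
  toSubmodule := (weightedSum ρ φ).eigenspace l ⊓ (weightedSum ρ ψ).eigenspace m
  apply_mem_toSubmodule g _ hv :=
    ⟨Module.End.mapsTo_genEigenspace_of_comm (commute_weightedSum ρ hφ g) l 1 hv.1,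
      Module.End.mapsTo_genEigenspace_of_comm (commute_weightedSum ρ hψ g) m 1 hv.2⟩

theorem weightedSum_eigenSubrepresentation {V : Type*} [AddCommGroup V] [Module ℂ V]
    (ρ : Representation ℂ Γ V) {φ ψ : Γ → ℂ} (hφ : ∀ s x, φ (x * s * x⁻¹) = φ s)
    (hψ : ∀ s x, ψ (x * s * x⁻¹) = ψ s) (l m : ℂ) :
    weightedSum (eigenSubrepresentation ρ hφ hψ l m).toRepresentation φ = l • 1 ∧
      weightedSum (eigenSubrepresentation ρ hφ hψ l m).toRepresentation ψ = m • 1 := by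
  constructor <;> refine LinearMap.ext fun v ↦ Subtype.ext ?_ <;>
    rw [weightedSum_toRepresentation_apply]
  · exact Module.End.mem_eigenspace_iff.1 v.2.1
  · exact Module.End.mem_eigenspace_iff.1 v.2.2

theorem weightedSum_comp_symm_eq_smul_one {V : Type*} [AddCommGroup V] [Module ℂ V]
    (ρ : Representation ℂ Γ V) (e : Γ ≃ Γ) {φ : Γ → ℂ} {l d : ℂ}
    (hl : weightedSum ρ φ = l • 1)
    (hd : weightedSum ρ (fun s ↦ φ s - φ (e.symm s)) = d • 1) :
    weightedSum ρ (fun s ↦ φ (e.symm s)) = (l - d) • 1 := by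
  rw [sub_smul, ← hl, ← hd]
  simp only [weightedSum, sub_smul, Finset.sum_sub_distrib, sub_sub_cancel]

/-- An eigenvalue of one of two commuting endomorphisms is part of a joint pair of eigenvalues. -/
theorem exists_joint_eigenspace_ne_bot {V : Type*} [AddCommGroup V] [Module ℂ V]
    [FiniteDimensional ℂ V] {S T : Module.End ℂ V} (h : Commute S T) {l : ℂ}
    (hl : S.HasEigenvalue l) : ∃ m, S.eigenspace l ⊓ T.eigenspace m ≠ ⊥ := by
  have hmaps := Module.End.mapsTo_genEigenspace_of_comm h l 1
  have : Nontrivial (S.eigenspace l) := Submodule.nontrivial_iff_ne_bot.2 hl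
  obtain ⟨m, hm⟩ := Module.End.exists_eigenvalue (T.restrict hmaps)
  obtain ⟨v, hv⟩ := hm.exists_hasEigenvector
  refine ⟨m, (Submodule.ne_bot_iff _).2 ⟨v, ⟨v.2, ?_⟩, fun h0 ↦ hv.2 (Subtype.ext h0)⟩⟩
  exact Module.End.mem_eigenspace_iff.2 (congrArg Subtype.val hv.apply_eq_smul)

variable [DecidableEq Γ]

/-- The eigenvalues of the matrix of a `K`-valued class function `f` all lie in `K` if and only if
`f` is invariant under the power maps induced by the Galois group of the field generated by the
roots of unity. -/
theorem spectrum_quotientMatrix_subset_range_iff {f : Γ → K}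
    (hf : ∀ s x, f (x * s * x⁻¹) = f s) {F : IntermediateField K ℂ}
    [IsGalois K F] [FiniteDimensional K F] (hF : ∀ z : ℂ, z ^ Fintype.card Γ = 1 → z ∈ F) :
    (∀ z ∈ spectrum ℂ (quotientMatrix fun s ↦ algebraMap K ℂ (f s)),
        z ∈ Set.range (algebraMap K ℂ)) ↔
      ∀ (σ : F ≃ₐ[K] F) (k : ℕ), (∀ z : F, z ^ Fintype.card Γ = 1 → σ z = z ^ k) →
        ∀ s, f (s ^ k) = f s := by
  obtain ⟨ζ, hζ⟩ : ∃ ζ : F, IsPrimitiveRoot ζ (Fintype.card Γ) := by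
    have h := Complex.isPrimitiveRoot_exp _ (Fintype.card_ne_zero (α := Γ))
    exact ⟨⟨_, hF _ h.pow_eq_one⟩, IsPrimitiveRoot.coe_submonoidClass_iff.1 h⟩
  have hperm : ∀ (σ : F ≃ₐ[K] F) (k : ℕ), (∀ z : F, z ^ Fintype.card Γ = 1 → σ z = z ^ k) →
      ∃ e : Γ ≃ Γ, ∀ s, e s = s ^ k := fun σ k hσ ↦ by
    have hcop : (Nat.card Γ).Coprime k := by
      rw [Nat.card_eq_fintype_card, Nat.coprime_comm, ← hζ.pow_iff_coprime Fintype.card_pos,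
        ← hσ ζ hζ.pow_eq_one]
      exact hζ.map_of_injective σ.injective
    exact ⟨powCoprime hcop, fun _ ↦ rfl⟩
  obtain ⟨φ, hφf⟩ : ∃ φ : Γ → ℂ, φ = fun s ↦ algebraMap K ℂ (f s) := ⟨_, rfl⟩
  have hφ : ∀ s x, φ (x * s * x⁻¹) = φ s := fun s x ↦ by simp only [hφf, hf]
  rw [← hφf]
  constructor
  · intro hspec σ k hσ
    obtain ⟨e, he⟩ := hperm σ k hσ
    have he_conj : ∀ s x, e.symm (x * s * x⁻¹) = x * e.symm s * x⁻¹ := fun s x ↦ by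
      rw [Equiv.symm_apply_eq]
      obtain ⟨t, rfl⟩ := e.surjective s
      rw [Equiv.symm_apply_apply, he, he, conj_pow]
    obtain ⟨u, hue⟩ : ∃ u : Γ → ℂ, u = fun s ↦ φ s - φ (e.symm s) := ⟨_, rfl⟩
    have hu : ∀ s x, u (x * s * x⁻¹) = u s := fun s x ↦ by
      simp only [hue, he_conj, hφ]
    have hzero := eq_zero_of_spectrum_quotientMatrix hu fun d hd ↦ by
      rw [← Matrix.spectrum_toLin', toLin'_quotientMatrix hu,
        ← Module.End.hasEigenvalue_iff_mem_spectrum] at hd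
      obtain ⟨l, hl⟩ := exists_joint_eigenspace_ne_bot
        (commute_weightedSum_weightedSum (rightRegular Γ) hu φ) hd
      obtain ⟨h₁, h₂⟩ := weightedSum_eigenSubrepresentation (rightRegular Γ) hu hφ d l
      set W := eigenSubrepresentation (rightRegular Γ) hu hφ d l
      have : Nontrivial W.toSubmodule := Submodule.nontrivial_iff_ne_bot.2 hl
      have h₃ := weightedSum_comp_symm_eq_smul_one W.toRepresentation e h₂ (hue ▸ h₁)
      obtain ⟨c, hc, hσc⟩ := exists_scalar_galois hF hσ W.toRepresentation f (l := l)
        (m := l - d) (by rw [← h₂, hφf, weightedSum]) (by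
          rw [← h₃, weightedSum]
          exact Fintype.sum_equiv e _ _ fun s ↦ by rw [Equiv.symm_apply_apply, he, hφf])
      obtain ⟨q, hq⟩ := hspec l (by
        rw [← Matrix.spectrum_toLin', toLin'_quotientMatrix hφ,
          ← Module.End.hasEigenvalue_iff_mem_spectrum]
        exact fun h ↦ hl (le_bot_iff.1 (inf_le_right.trans h.le)))
      obtain rfl : c = algebraMap K F q := Subtype.ext (hc.trans hq.symm)
      rw [AlgEquiv.commutes, hc] at hσc
      linear_combination hσc
    intro s
    have := hzero (e s)
    simp only [hue, Equiv.symm_apply_apply, sub_eq_zero, hφf] at this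
    rw [he] at this
    exact (algebraMap K ℂ).injective this
  · intro hpow l hl
    rw [← Matrix.spectrum_toLin', toLin'_quotientMatrix hφ,
      ← Module.End.hasEigenvalue_iff_mem_spectrum] at hl
    obtain ⟨h, -⟩ := weightedSum_eigenSubrepresentation (rightRegular Γ) hφ hφ l l
    set W := eigenSubrepresentation (rightRegular Γ) hφ hφ l l
    have : Nontrivial W.toSubmodule := Submodule.nontrivial_iff_ne_bot.2 (by
      rw [Module.End.hasEigenvalue_iff] at hl
      simpa [W, eigenSubrepresentation] using hl)
    have key : ∀ σ : F ≃ₐ[K] F, ∃ c : F, (c : ℂ) = l ∧ (σ c : ℂ) = l := fun σ ↦ by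
      obtain ⟨k, hσ⟩ : ∃ k : ℕ, ∀ z : F, z ^ Fintype.card Γ = 1 → σ z = z ^ k := by
        obtain ⟨k, -, hk⟩ := hζ.isPrimitiveRoot_iff.1
          (hζ.map_of_injective σ.injective)
        refine ⟨k, fun z hz ↦ ?_⟩
        obtain ⟨i, -, rfl⟩ := hζ.eq_pow_of_pow_eq_one hz
        rw [map_pow, ← hk.2, pow_right_comm]
      obtain ⟨e, he⟩ := hperm σ k hσ
      rw [weightedSum, hφf] at h
      refine exists_scalar_galois hF hσ W.toRepresentation f h ?_
      rw [← h]
      exact Fintype.sum_equiv e _ _ fun s ↦ by simp only [he, hpow σ k hσ s]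
    obtain ⟨c, rfl, -⟩ := key 1
    obtain ⟨q, rfl⟩ := (IsGalois.mem_range_algebraMap_iff_fixed c).2 fun σ ↦ by
      obtain ⟨c', hc', hσ⟩ := key σ
      obtain rfl := Subtype.ext hc'
      exact Subtype.ext hσ
    exact ⟨q, rfl⟩

end GaloisTwist

/-- The field `ℚ(i)`. -/
noncomputable abbrev gaussianRationals : IntermediateField ℚ ℂ :=
  IntermediateField.adjoin ℚ {Complex.I}

theorem exists_rat_of_mem_gaussianRationals {z : ℂ} (hz : z ∈ gaussianRationals) :
    ∃ a b : ℚ, z = a + b * Complex.I := by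
  have hI : IsAlgebraic ℚ Complex.I :=
    ⟨Polynomial.X ^ 2 + 1, (Polynomial.monic_X_pow_add_C (1 : ℚ) two_ne_zero).ne_zero, by simp⟩
  rw [← IntermediateField.mem_toSubalgebra,
    IntermediateField.adjoin_simple_toSubalgebra_of_isAlgebraic hI] at hz
  induction hz using Algebra.adjoin_induction with
  | mem x hx => exact ⟨0, 1, by simp_all⟩
  | algebraMap r => exact ⟨r, 0, by simp⟩
  | add x y _ _ hx hy =>
    obtain ⟨a, b, rfl⟩ := hx
    obtain ⟨c, d, rfl⟩ := hy
    exact ⟨a + c, b + d, by push_cast; ring⟩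
  | mul x y _ _ hx hy =>
    obtain ⟨a, b, rfl⟩ := hx
    obtain ⟨c, d, rfl⟩ := hy
    exact ⟨a * c - b * d, a * d + b * c, by
      push_cast; linear_combination (b * d : ℂ) * Complex.I_mul_I⟩

theorem exists_int_of_isIntegral_ratCast {q : ℚ} (h : IsIntegral ℤ (q : ℂ)) :
    ∃ m : ℤ, (m : ℚ) = q :=
  IsIntegrallyClosed.isIntegral_iff.1 <|
    (isIntegral_algHom_iff (algebraMap ℚ ℂ).toIntAlgHom (algebraMap ℚ ℂ).injective).1 h

theorem isIntegral_complex_I : IsIntegral ℤ Complex.I :=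
  ⟨Polynomial.X ^ 2 + 1, Polynomial.monic_X_pow_add_C (1 : ℤ) two_ne_zero, by simp⟩

/-- `ℤ[i]` is integrally closed in `ℚ(i)`. -/
theorem exists_int_of_mem_gaussianRationals_of_isIntegral {z : ℂ} (hz : z ∈ gaussianRationals)
    (hint : IsIntegral ℤ z) : ∃ p q : ℤ, z = p + q * Complex.I := by
  obtain ⟨a, b, rfl⟩ := exists_rat_of_mem_gaussianRationals hz
  have hconj : IsIntegral ℤ ((a : ℂ) - b * Complex.I) := by
    simpa [sub_eq_add_neg] using hint.map (starRingEnd ℂ).toIntAlgHom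
  obtain ⟨m, hm⟩ := exists_int_of_isIntegral_ratCast (q := 2 * a) (by
    rw [show ((2 * a : ℚ) : ℂ) = a + b * Complex.I + (a - b * Complex.I) by push_cast; ring]
    exact hint.add hconj)
  obtain ⟨n, hn⟩ := exists_int_of_isIntegral_ratCast (q := 2 * b) (by
    rw [show ((2 * b : ℚ) : ℂ) = (a - b * Complex.I - (a + b * Complex.I)) * Complex.I by
      push_cast
      linear_combination (2 * b : ℂ) * Complex.I_mul_I]
    exact (hconj.sub hint).mul isIntegral_complex_I)
  obtain ⟨r, hr⟩ := exists_int_of_isIntegral_ratCast (q := a ^ 2 + b ^ 2) (by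
    rw [show ((a ^ 2 + b ^ 2 : ℚ) : ℂ) = (a + b * Complex.I) * (a - b * Complex.I) by
      push_cast
      linear_combination (b ^ 2 : ℂ) * Complex.I_mul_I]
    exact hint.mul hconj)
  have hsq : m ^ 2 + n ^ 2 = 4 * r := by
    have : (m ^ 2 + n ^ 2 : ℚ) = 4 * r := by rw [hm, hn, hr]; ring
    exact_mod_cast this
  have hpar : Even m ∧ Even n := by
    have := congrArg (fun t : ℤ ↦ t % 4) hsq
    rcases Int.even_or_odd' m with ⟨u, rfl | rfl⟩ <;> rcases Int.even_or_odd' n with ⟨v, rfl | rfl⟩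
      <;> ring_nf at this <;> first | omega | simp [parity_simps]
  obtain ⟨⟨p, rfl⟩, q, rfl⟩ := hpar
  refine ⟨p, q, ?_⟩
  have ha : a = p := by push_cast at hm; linarith
  have hb : b = q := by push_cast at hn; linarith
  simp [ha, hb]

theorem isIntegral_of_mem_spectrum {ι : Type*} [Fintype ι] [DecidableEq ι] {M : Matrix ι ι ℂ}
    (hM : ∀ a b, IsIntegral ℤ (M a b)) {z : ℂ} (hz : z ∈ spectrum ℂ M) : IsIntegral ℤ z := by
  let N : Matrix ι ι (integralClosure ℤ ℂ) := Matrix.of fun a b ↦ ⟨M a b, hM a b⟩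
  have hN : M = N.map (algebraMap (integralClosure ℤ ℂ) ℂ) := rfl
  rw [Matrix.mem_spectrum_iff_isRoot_charpoly, hN, Matrix.charpoly_map, Polynomial.IsRoot,
    Polynomial.eval_map] at hz
  exact isIntegral_trans (A := integralClosure ℤ ℂ) z ⟨N.charpoly, N.charpoly_monic, hz⟩

open scoped Matrix.Norms.L2Operator in
theorem Matrix.IsHermitian.im_eq_zero_of_mem_spectrum {ι : Type*} [Fintype ι] [DecidableEq ι]
    {M : Matrix ι ι ℂ} (hM : M.IsHermitian) {z : ℂ} (hz : z ∈ spectrum ℂ M) : z.im = 0 :=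
  IsSelfAdjoint.im_eq_zero_of_mem_spectrum hM.isSelfAdjoint hz

/-- A matrix of algebraic integers is Gaussian integral as soon as its eigenvalues lie in `ℚ(i)`. -/
theorem matrixGaussianIntegral_iff {Γ : Type} [Fintype Γ] [DecidableEq Γ] {M : Matrix Γ Γ ℂ}
    (hM : ∀ a b, IsIntegral ℤ (M a b)) :
    MatrixGaussianIntegral M ↔
      ∀ z ∈ spectrum ℂ M, z ∈ Set.range (algebraMap gaussianRationals ℂ) := by
  refine forall₂_congr fun z hz ↦ ⟨?_, ?_⟩
  · rintro ⟨p, q, rfl⟩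
    have hI : Complex.I ∈ gaussianRationals := IntermediateField.mem_adjoin_simple_self ℚ _
    exact ⟨⟨_, add_mem (intCast_mem _ p) (mul_mem (intCast_mem _ q) hI)⟩, rfl⟩
  · rintro ⟨w, rfl⟩
    exact exists_int_of_mem_gaussianRationals_of_isIntegral w.2 (isIntegral_of_mem_spectrum hM hz)

/-- A Hermitian matrix has real eigenvalues, so for it integrality and Gaussian integrality
agree. -/
theorem matrixIntegral_iff_matrixGaussianIntegral {Γ : Type} [Fintype Γ] [DecidableEq Γ]
    {M : Matrix Γ Γ ℂ} (hM : M.IsHermitian) : MatrixIntegral M ↔ MatrixGaussianIntegral M := by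
  refine forall₂_congr fun z hz ↦ ⟨fun ⟨k, hk⟩ ↦ ⟨k, 0, by simp [hk]⟩, ?_⟩
  rintro ⟨p, q, rfl⟩
  have hq := hM.im_eq_zero_of_mem_spectrum hz
  refine ⟨p, ?_⟩
  simp_all

/-- A normal mixed Cayley graph `Cay(Γ, S)` is H-integral iff it is Gaussian integral. -/
theorem normal_mixed_cayley_HIntegral_iff_gaussian_integral
    (Γ : Type) [Group Γ] [Fintype Γ] [DecidableEq Γ]
    (S : Finset Γ) (hS1 : (1 : Γ) ∉ S)
    (hnormal : ∀ s ∈ S, ∀ x : Γ, x * s * x⁻¹ ∈ S)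
    :
    MatrixIntegral (hermitianAdjMatrix S) ↔ MatrixGaussianIntegral (adjMatrix01 S) := by
  have hconj : ∀ s x : Γ, x * s * x⁻¹ ∈ S ↔ s ∈ S := fun s x ↦
    ⟨fun h ↦ by simpa [mul_assoc] using hnormal _ h x⁻¹, fun h ↦ hnormal s h x⟩
  have hconj_inv : ∀ s x : Γ, (x * s * x⁻¹)⁻¹ ∈ S ↔ s⁻¹ ∈ S := fun s x ↦ by
    rw [← hconj s⁻¹ x, conj_inv]
  have hherm : (hermitianAdjMatrix S).IsHermitian := by
    ext a b
    simp only [hermitianAdjMatrix, Matrix.conjTranspose_apply, Matrix.of_apply]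
    split_ifs <;> simp
  have hHint : ∀ a b, IsIntegral ℤ (hermitianAdjMatrix S a b) := fun a b ↦ by
    simp only [hermitianAdjMatrix, Matrix.of_apply]
    split_ifs
    exacts [isIntegral_one, isIntegral_complex_I, isIntegral_complex_I.neg, isIntegral_zero]
  have hAint : ∀ a b, IsIntegral ℤ (adjMatrix01 S a b) := fun a b ↦ by
    simp only [adjMatrix01, Matrix.of_apply]
    split_ifs
    exacts [isIntegral_one, isIntegral_zero]
  let i : gaussianRationals := ⟨Complex.I, IntermediateField.mem_adjoin_simple_self ℚ _⟩
  have hi : i * i = -1 := Subtype.ext Complex.I_mul_I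
  let fA : Γ → gaussianRationals := fun s ↦ if s ∈ S then 1 else 0
  let fH : Γ → gaussianRationals := fun s ↦
    if s ∈ S then (if s⁻¹ ∈ S then 1 else i) else (if s⁻¹ ∈ S then -i else 0)
  have hA : adjMatrix01 S = quotientMatrix fun s ↦ algebraMap gaussianRationals ℂ (fA s) := by
    ext a b
    simp only [adjMatrix01, quotientMatrix, Matrix.of_apply, fA]
    split_ifs <;> simp
  have hH : hermitianAdjMatrix S =
      quotientMatrix fun s ↦ algebraMap gaussianRationals ℂ (fH s) := by
    ext a b
    simp only [hermitianAdjMatrix, quotientMatrix, Matrix.of_apply, fH, mul_inv_rev, inv_inv]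
    split_ifs <;> simp [i]
  have := IntermediateField.isCyclotomicExtension_adjoin_of_exists_isPrimitiveRoot
    {Fintype.card Γ} gaussianRationals ℂ fun n _ hn ↦ ⟨_, Complex.isPrimitiveRoot_exp n hn⟩
  have := IsCyclotomicExtension.isGalois {Fintype.card Γ} gaussianRationals
    (IntermediateField.adjoin gaussianRationals
      {b : ℂ | ∃ n ∈ ({Fintype.card Γ} : Set ℕ), n ≠ 0 ∧ b ^ n = 1})
  have := IsCyclotomicExtension.finiteDimensional {Fintype.card Γ} gaussianRationals
    (IntermediateField.adjoin gaussianRationals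
      {b : ℂ | ∃ n ∈ ({Fintype.card Γ} : Set ℕ), n ≠ 0 ∧ b ^ n = 1})
  have hF : ∀ z : ℂ, z ^ Fintype.card Γ = 1 → z ∈ IntermediateField.adjoin gaussianRationals
      {b : ℂ | ∃ n ∈ ({Fintype.card Γ} : Set ℕ), n ≠ 0 ∧ b ^ n = 1} := fun z hz ↦
    IntermediateField.subset_adjoin _ _ ⟨_, rfl, Fintype.card_ne_zero, hz⟩
  rw [matrixIntegral_iff_matrixGaussianIntegral hherm, matrixGaussianIntegral_iff hHint,
    matrixGaussianIntegral_iff hAint, hA, hH,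
    spectrum_quotientMatrix_subset_range_iff (fun s x ↦ by simp only [fH, hconj, hconj_inv]) hF,
    spectrum_quotientMatrix_subset_range_iff (fun s x ↦ by simp only [fA, hconj]) hF]
  refine forall₃_congr fun σ k _ ↦ ?_
  have hfA : ∀ s t, fA s = fA t ↔ (s ∈ S ↔ t ∈ S) := fun s t ↦ by
    simp only [fA]
    split_ifs <;> simp_all
  have hmem : ∀ s, s ∈ S ↔ fH s = 1 ∨ fH s = i := fun s ↦ by
    have h1 : -i ≠ 1 := fun h ↦ by grind
    have h2 : -i ≠ i := fun h ↦ by grind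
    have h3 : (0 : gaussianRationals) ≠ i := fun h ↦ by grind
    simp only [fH]
    split_ifs <;> simp_all
  constructor
  · intro h s
    rw [hfA, hmem, hmem s, h]
  · intro h s
    have h₁ := (hfA _ _).1 (h s)
    have h₂ := (hfA _ _).1 (h s⁻¹)
    rw [inv_pow] at h₂
    simp only [fH, h₁, h₂]
end
end
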